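/- For every real a > 0 and all natural numbers m ≠ n, the series \(\sum_{x=0}^{\infty} C_m(x;a)\, C_n(x;a)\, \frac{a^x}{x!}\) converges absolutely and equals 0. -/

import Mathlib

open Nat

/-- The Pochhammer symbol `(a)_k = a (a+1) ⋯ (a+k-1)`. -/
noncomputable def poch (a : ℝ) (k : ℕ) : ℝ :=
  ∏ j ∈ Finset.range k, (a + (j : ℝ))

/-- The Charlier polynomials
`C_n(x;a) = ∑_{k=0}^n (-n)_k (-x)_k / k! · (-1/a)^k`. -/
noncomputable def charlier (n : ℕ) (x : ℕ) (a : ℝ) : ℝ :=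
  ∑ k ∈ Finset.range (n + 1),
    poch (-(n : ℝ)) k * poch (-(x : ℝ)) k / (k ! : ℝ) * (-(1 / a)) ^ k

lemma poch_neg_natCast (n k : ℕ) :
    poch (-(n : ℝ)) k = (-1) ^ k * (n.descFactorial k : ℝ) := by
  induction k with
  | zero => simp [poch]
  | succ k ih =>
    have h : poch (-(n : ℝ)) (k + 1) = poch (-(n : ℝ)) k * (-(n : ℝ) + k) := by
      simp [poch, Finset.prod_range_succ]
    rw [h, ih, Nat.descFactorial_succ]
    rcases le_or_gt k n with hk | hk
    · push_cast [Nat.cast_sub hk]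
      ring
    · simp [Nat.descFactorial_eq_zero_iff_lt.mpr hk]

lemma charlier_eq_sum_choose (n x : ℕ) (a : ℝ) :
    charlier n x a = ∑ k ∈ Finset.range (n + 1),
      (n.choose k : ℝ) * (x.descFactorial k : ℝ) * (-(1 / a)) ^ k := by
  refine Finset.sum_congr rfl fun k _ => ?_
  have hk : (k ! : ℝ) ≠ 0 := by positivity
  have hs : ((-1 : ℝ) ^ k) * (-1) ^ k = 1 := by rw [← mul_pow]; simp
  rw [poch_neg_natCast, poch_neg_natCast, Nat.descFactorial_eq_factorial_mul_choose n k]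
  push_cast
  field_simp
  linear_combination (n.choose k : ℝ) * (x.descFactorial k : ℝ) * (-(1 / a)) ^ k * hs

lemma charlier_zero_left (x : ℕ) (a : ℝ) : charlier 0 x a = 1 := by
  simp [charlier_eq_sum_choose]

lemma charlier_zero_right (n : ℕ) (a : ℝ) : charlier n 0 a = 1 := by
  simp [charlier_eq_sum_choose, Finset.sum_range_succ']

lemma charlier_succ_succ (n x : ℕ) (a : ℝ) :
    charlier (n + 1) (x + 1) a =
      charlier n (x + 1) a - ((x : ℝ) + 1) / a * charlier n x a := by
  have h : charlier n (x + 1) a = ∑ k ∈ Finset.range (n + 2),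
      (n.choose k : ℝ) * ((x + 1).descFactorial k : ℝ) * (-(1 / a)) ^ k := by
    rw [Finset.sum_range_succ, charlier_eq_sum_choose]
    simp
  rw [h, charlier_eq_sum_choose, charlier_eq_sum_choose, Finset.sum_range_succ',
    Finset.sum_range_succ' _ (n + 1), Finset.mul_sum, add_sub_right_comm,
    ← Finset.sum_sub_distrib]
  congr 1
  · refine Finset.sum_congr rfl fun k _ => ?_
    rw [Nat.choose_succ_succ, Nat.succ_descFactorial_succ]
    push_cast
    ring
  · simp

lemma charlier_succ_forward_diff (n x : ℕ) (a : ℝ) :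
    charlier (n + 1) (x + 1) a =
      charlier (n + 1) x a - ((n : ℝ) + 1) / a * charlier n x a := by
  rw [charlier_eq_sum_choose, charlier_eq_sum_choose, charlier_eq_sum_choose,
    Finset.sum_range_succ', Finset.sum_range_succ' _ (n + 1), Finset.mul_sum,
    add_sub_right_comm, ← Finset.sum_sub_distrib]
  congr 1
  refine Finset.sum_congr rfl fun k _ => ?_
  have h1 : ((n : ℝ) + 1) * n.choose k = (n + 1).choose (k + 1) * ((k : ℝ) + 1) := by
    exact_mod_cast Nat.add_one_mul_choose_eq n k
  have h2 : ((x + 1).descFactorial (k + 1) : ℝ) =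
      x.descFactorial (k + 1) + ((k : ℝ) + 1) * x.descFactorial k := by
    rw [Nat.succ_descFactorial_succ, Nat.descFactorial_succ]
    rcases le_or_gt k x with hk | hk
    · push_cast [Nat.cast_sub hk]
      ring
    · simp [Nat.descFactorial_eq_zero_iff_lt.mpr hk]
  rw [h2]
  linear_combination (x.descFactorial k : ℝ) * (-(1 / a)) ^ k * (1 / a) * h1

lemma abs_charlier_le {a : ℝ} (ha : 0 < a) (n x : ℕ) :
    |charlier n x a| ≤ (1 + (x : ℝ) / a) ^ n := by
  induction n generalizing x with
  | zero => simp [charlier_zero_left]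
  | succ n ih =>
    cases x with
    | zero => simp [charlier_zero_right]
    | succ x =>
      have hx : 0 ≤ ((x : ℝ) + 1) / a := by positivity
      have hle : (1 + (x : ℝ) / a) ^ n ≤ (1 + ((x : ℝ) + 1) / a) ^ n := by
        gcongr
        linarith
      have h1 := ih (x + 1)
      push_cast at h1 ⊢
      calc |charlier (n + 1) (x + 1) a|
          ≤ |charlier n (x + 1) a| + |((x : ℝ) + 1) / a * charlier n x a| := by
            rw [charlier_succ_succ]
            exact abs_sub _ _
        _ = |charlier n (x + 1) a| + ((x : ℝ) + 1) / a * |charlier n x a| := by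
            rw [abs_mul, abs_of_nonneg hx]
        _ ≤ (1 + ((x : ℝ) + 1) / a) ^ n +
              ((x : ℝ) + 1) / a * (1 + ((x : ℝ) + 1) / a) ^ n := by
            gcongr
            exact (ih x).trans hle
        _ = (1 + ((x : ℝ) + 1) / a) ^ (n + 1) := by ring

lemma summable_abs_charlier_mul {a : ℝ} (ha : 0 < a) (m n : ℕ) :
    Summable fun x : ℕ => |charlier m x a * charlier n x a * (a ^ x / (x ! : ℝ))| := by
  refine Summable.of_nonneg_of_le (fun _ => abs_nonneg _) (fun x => ?_)
    ((Real.summable_pow_div_factorial (Real.exp (1 / a) * a)).mul_left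
      (((m + n) ! : ℝ) * Real.exp 1))
  have hx : 0 ≤ 1 + (x : ℝ) / a := by positivity
  have hw : 0 ≤ a ^ x / (x ! : ℝ) := by positivity
  have hexp : (1 + (x : ℝ) / a) ^ (m + n) ≤
      ((m + n) ! : ℝ) * (Real.exp 1 * Real.exp (1 / a) ^ x) := by
    have h := Real.pow_div_factorial_le_exp _ hx (m + n)
    rw [div_le_iff₀ (by positivity)] at h
    rw [← Real.exp_nat_mul, ← Real.exp_add, mul_one_div, mul_comm]
    exact h
  rw [abs_mul, abs_mul, abs_of_nonneg hw]
  calc |charlier m x a| * |charlier n x a| * (a ^ x / (x ! : ℝ))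
      ≤ (1 + (x : ℝ) / a) ^ m * (1 + (x : ℝ) / a) ^ n * (a ^ x / (x ! : ℝ)) := by
        gcongr
        · exact abs_charlier_le ha m x
        · exact abs_charlier_le ha n x
    _ = (1 + (x : ℝ) / a) ^ (m + n) * (a ^ x / (x ! : ℝ)) := by rw [pow_add]
    _ ≤ ((m + n) ! : ℝ) * (Real.exp 1 * Real.exp (1 / a) ^ x) * (a ^ x / (x ! : ℝ)) := by
        gcongr
    _ = ((m + n) ! : ℝ) * Real.exp 1 * ((Real.exp (1 / a) * a) ^ x / (x ! : ℝ)) := by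
        rw [mul_pow]
        ring

/-- Summation by parts against the Poisson weight: raising the degree of the Charlier polynomial
amounts to taking a forward difference of the other factor. -/
lemma hasSum_charlier_succ_mul {a : ℝ} (ha : a ≠ 0) {n : ℕ} {f : ℕ → ℝ} {A B : ℝ}
    (hA : HasSum (fun x : ℕ => f x * charlier n x a * (a ^ x / (x ! : ℝ))) A)
    (hB : HasSum (fun x : ℕ => f (x + 1) * charlier n x a * (a ^ x / (x ! : ℝ))) B) :
    HasSum (fun x : ℕ => f x * charlier (n + 1) x a * (a ^ x / (x ! : ℝ))) (A - B) := by
  have hshift : HasSum (fun x : ℕ => f x * ((x : ℝ) / a * charlier n (x - 1) a) *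
      (a ^ x / (x ! : ℝ))) B := by
    rw [← hasSum_nat_add_iff' 1]
    convert hB using 1
    · rfl
    · funext x
      rw [Nat.factorial_succ, Nat.add_sub_cancel]
      push_cast
      field_simp
      ring
    · simp
  convert hA.sub hshift using 1
  · rfl
  funext x
  cases x with
  | zero => simp [charlier_zero_right]
  | succ x =>
    rw [charlier_succ_succ, Nat.add_sub_cancel]
    push_cast
    ring

lemma hasSum_charlier_mul_of_lt {a : ℝ} (ha : 0 < a) {m n : ℕ} (hmn : m < n) :
    HasSum (fun x : ℕ => charlier m x a * charlier n x a * (a ^ x / (x ! : ℝ))) 0 := by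
  induction n generalizing m with
  | zero => omega
  | succ n ih =>
    have hA := (summable_abs_charlier_mul ha m n).of_abs.hasSum
    rw [← sub_self (∑' x : ℕ, charlier m x a * charlier n x a * (a ^ x / (x ! : ℝ)))]
    refine hasSum_charlier_succ_mul (f := fun x => charlier m x a) ha.ne' hA ?_
    cases m with
    | zero => simpa only [charlier_zero_left] using hA
    | succ m =>
      convert hA.sub ((ih (m := m) (by omega)).mul_left (((m : ℝ) + 1) / a)) using 1
      · rfl
      · funext x
        rw [charlier_succ_forward_diff]
        ring
      · simp

/-- Orthogonality of the Charlier polynomials: for `m ≠ n`,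
`∑_{x=0}^∞ C_m(x;a) C_n(x;a) a^x/x!` converges absolutely and equals `0`. -/
theorem charlier_orthogonality (a : ℝ) (ha : 0 < a) (m n : ℕ) (hmn : m ≠ n) :
    Summable (fun x : ℕ => |charlier m x a * charlier n x a * (a ^ x / (x ! : ℝ))|) ∧
    HasSum (fun x : ℕ => charlier m x a * charlier n x a * (a ^ x / (x ! : ℝ))) 0 := by
  refine ⟨summable_abs_charlier_mul ha m n, ?_⟩
  rcases hmn.lt_or_gt with h | h
  · exact hasSum_charlier_mul_of_lt ha h
  · simpa only [mul_comm (charlier m _ a)] using hasSum_charlier_mul_of_lt ha h
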